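/- Let Ω ⊂ ℝⁿ (n ≥ 2) be a bounded open set, let 1 < p < ∞, and let c₀ > 0. Let σ₁, σ₂ : closure(Ω) → ℝ be continuous with σⱼ ≥ c₀ on Ω, and let A : closure(Ω) → (n×n real matrices) be continuous with A(x) symmetric and A(x)ξ·ξ ≥ c₀|ξ|² for all x ∈ Ω and ξ ∈ ℝⁿ. Suppose u₂ ∈ C¹(closure Ω) is a weak solution of div(σ₂|A∇u₂·∇u₂|^{(p−2)/2}A∇u₂) = 0 in Ω, and u₁ ∈ C¹(closure Ω) satisfies u₁ = u₂ on ∂Ω and minimizes the energy E_{σ₁,A} among all v ∈ C¹(closure Ω) with v = u₂ on ∂Ω. Then (p−1)·∫_Ω σ₂(x)·σ₁(x)^{−1/(p−1)}·(σ₁(x)^{1/(p−1)} − σ₂(x)^{1/(p−1)})·|A(x)∇u₂(x)·∇u₂(x)|^{p/2} dx ≤ E_{σ₁,A}(u₁) − E_{σ₂,A}(u₂) ≤ ∫_Ω (σ₁(x) − σ₂(x))·|A(x)∇u₂(x)·∇u₂(x)|^{p/2} dx. -/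

import Mathlib

open MeasureTheory Real
open scoped RealInnerProductSpace

/-- The linear action of an `n × n` real matrix on Euclidean space, as a
continuous linear map. -/
noncomputable def matCLM {n : ℕ} (M : Matrix (Fin n) (Fin n) ℝ) :
    EuclideanSpace ℝ (Fin n) →L[ℝ] EuclideanSpace ℝ (Fin n) :=
  LinearMap.toContinuousLinearMap (Matrix.toEuclideanLin M)

/-- `u` is a weak solution of `div(σ |A∇u·∇u|^((p-2)/2) A∇u) = 0` in `Ω`,
tested against `C¹(closure Ω)` functions vanishing on `∂Ω`. -/
def IsWeakSolution {n : ℕ} (Ω : Set (EuclideanSpace ℝ (Fin n))) (p : ℝ)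
    (σ : EuclideanSpace ℝ (Fin n) → ℝ)
    (A : EuclideanSpace ℝ (Fin n) → Matrix (Fin n) (Fin n) ℝ)
    (u : EuclideanSpace ℝ (Fin n) → ℝ) : Prop :=
  ∀ φ : EuclideanSpace ℝ (Fin n) → ℝ, ContDiffOn ℝ 1 φ (closure Ω) →
    (∀ x ∈ frontier Ω, φ x = 0) →
    ∫ x in Ω, σ x * |⟪matCLM (A x) (gradient u x), gradient u x⟫| ^ ((p - 2) / 2)
      * ⟪matCLM (A x) (gradient u x), gradient φ x⟫ = 0

/-- The `p`-Dirichlet energy `E_{σ,A}(v) = ∫_Ω σ |A∇v·∇v|^(p/2) dx`. -/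
noncomputable def energy {n : ℕ} (Ω : Set (EuclideanSpace ℝ (Fin n))) (p : ℝ)
    (σ : EuclideanSpace ℝ (Fin n) → ℝ)
    (A : EuclideanSpace ℝ (Fin n) → Matrix (Fin n) (Fin n) ℝ)
    (v : EuclideanSpace ℝ (Fin n) → ℝ) : ℝ :=
  ∫ x in Ω, σ x * |⟪matCLM (A x) (gradient v x), gradient v x⟫| ^ (p / 2)

open Topology

/-- Young's inequality in the form comparing the cross term `s₂ a^((p-2)/2) c` with the two
energy densities `s₁ b^(p/2)` and `a^(p/2)`. -/
lemma weighted_young {p a b c s₁ s₂ : ℝ} (hp : 1 < p) (ha : 0 ≤ a) (hb : 0 ≤ b)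
    (hc : c ^ 2 ≤ a * b) (hs₁ : 0 < s₁) (hs₂ : 0 < s₂) :
    p * (s₂ * a ^ ((p - 2) / 2) * |c|) ≤
      s₁ * b ^ (p / 2)
        + (p - 1) * ((s₂ / s₁ ^ (1 / (p - 1)) * s₂ ^ (1 / (p - 1))) * a ^ (p / 2)) := by
  have hp0 : 0 < p := by linarith
  have hp1 : 0 < p - 1 := by linarith
  rcases ha.eq_or_lt with rfl | ha'
  · have hc0 : c = 0 := by
      have : c ^ 2 = 0 := le_antisymm (by simpa using hc) (sq_nonneg c)
      simpa using this
    subst hc0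
    simp only [abs_zero, mul_zero]
    positivity
  have hcab : |c| ≤ a ^ (1 / 2 : ℝ) * b ^ (1 / 2 : ℝ) := by
    rw [← Real.mul_rpow ha hb, ← Real.sqrt_eq_rpow]
    exact Real.abs_le_sqrt hc
  have hpq : p.HolderConjugate (p / (p - 1)) := Real.HolderConjugate.conjExponent hp
  have young := Real.young_inequality_of_nonneg
    (a := s₁ ^ (1 / p) * b ^ (1 / 2 : ℝ)) (b := s₂ * s₁ ^ (-(1 / p)) * a ^ ((p - 1) / 2))
    (by positivity) (by positivity) hpq
  have hX : (s₁ ^ (1 / p) * b ^ (1 / 2 : ℝ)) ^ p = s₁ * b ^ (p / 2) := by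
    rw [Real.mul_rpow (by positivity) (by positivity), ← Real.rpow_mul hs₁.le,
      ← Real.rpow_mul hb, one_div_mul_cancel hp0.ne', Real.rpow_one]
    ring_nf
  have hY : (s₂ * s₁ ^ (-(1 / p)) * a ^ ((p - 1) / 2)) ^ (p / (p - 1))
      = (s₂ / s₁ ^ (1 / (p - 1)) * s₂ ^ (1 / (p - 1))) * a ^ (p / 2) := by
    rw [Real.mul_rpow (by positivity) (by positivity), Real.mul_rpow hs₂.le (by positivity),
      ← Real.rpow_mul hs₁.le, ← Real.rpow_mul ha]
    have e₁ : p / (p - 1) = 1 + 1 / (p - 1) := by field_simp; ring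
    have e₂ : -(1 / p) * (p / (p - 1)) = -(1 / (p - 1)) := by field_simp
    have e₃ : (p - 1) / 2 * (p / (p - 1)) = p / 2 := by field_simp
    rw [e₂, e₃, e₁, Real.rpow_add hs₂, Real.rpow_one, Real.rpow_neg hs₁.le]
    ring
  have hXY : s₁ ^ (1 / p) * b ^ (1 / 2 : ℝ) * (s₂ * s₁ ^ (-(1 / p)) * a ^ ((p - 1) / 2))
      = s₂ * a ^ ((p - 2) / 2) * (a ^ (1 / 2 : ℝ) * b ^ (1 / 2 : ℝ)) := by
    have e : (p - 1) / 2 = (p - 2) / 2 + 1 / 2 := by ring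
    have h : s₁ ^ (1 / p) * s₁ ^ (-(1 / p)) = 1 := by
      rw [← Real.rpow_add hs₁, add_neg_cancel, Real.rpow_zero]
    rw [e, Real.rpow_add ha']
    linear_combination (b ^ (1 / 2 : ℝ) * s₂ * a ^ ((p - 2) / 2) * a ^ (1 / 2 : ℝ)) * h
  rw [hX, hY, hXY] at young
  calc p * (s₂ * a ^ ((p - 2) / 2) * |c|)
      ≤ p * (s₂ * a ^ ((p - 2) / 2) * (a ^ (1 / 2 : ℝ) * b ^ (1 / 2 : ℝ))) := by gcongr
    _ ≤ p * _ := mul_le_mul_of_nonneg_left young hp0.le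
    _ = _ := by field_simp

/-- Cauchy-Schwarz for the quadratic form of a nonnegative symmetric matrix. -/
lemma inner_matCLM_sq_le {n : ℕ} {M : Matrix (Fin n) (Fin n) ℝ} (hM : M.IsSymm)
    (hpos : ∀ ξ : EuclideanSpace ℝ (Fin n), 0 ≤ ⟪matCLM M ξ, ξ⟫)
    (ξ η : EuclideanSpace ℝ (Fin n)) :
    ⟪matCLM M ξ, η⟫ ^ 2 ≤ ⟪matCLM M ξ, ξ⟫ * ⟪matCLM M η, η⟫ := by
  have hsymm : ⟪matCLM M η, ξ⟫ = ⟪matCLM M ξ, η⟫ := by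
    have hM' : M.IsHermitian := by
      rw [Matrix.IsHermitian, Matrix.conjTranspose_eq_transpose_of_trivial]
      exact hM
    rw [real_inner_comm]
    exact ((Matrix.isSymmetric_toEuclideanLin_iff.mpr hM') ξ η).symm
  have hquad : ∀ t : ℝ, 0 ≤ ⟪matCLM M η, η⟫ * (t * t) + 2 * ⟪matCLM M ξ, η⟫ * t
      + ⟪matCLM M ξ, ξ⟫ := by
    intro t
    have h := hpos (ξ + t • η)
    simp only [map_add, map_smul, inner_add_left, inner_add_right, inner_smul_left,
      inner_smul_right, hsymm, RCLike.conj_to_real] at h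
    linarith
  have h := discrim_le_zero hquad
  rw [discrim] at h
  linarith

lemma continuous_matCLM {n : ℕ} :
    Continuous (matCLM : Matrix (Fin n) (Fin n) ℝ →
      EuclideanSpace ℝ (Fin n) →L[ℝ] EuclideanSpace ℝ (Fin n)) :=
  LinearMap.continuous_of_finiteDimensional
    ((LinearMap.toContinuousLinearMap.toLinearMap).comp
      (Matrix.toEuclideanLin (𝕜 := ℝ) (m := Fin n) (n := Fin n)).toLinearMap)

section Gradient

variable {E : Type*} [NormedAddCommGroup E] [InnerProductSpace ℝ E] [CompleteSpace E]
  {Ω : Set E} {u : E → ℝ}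

lemma ContDiffOn.continuousOn_gradient (hΩ : IsOpen Ω) (hu : ContDiffOn ℝ 1 u Ω) :
    ContinuousOn (gradient u) Ω :=
  (InnerProductSpace.toDual ℝ E).symm.continuous.comp_continuousOn
    (hu.continuousOn_fderiv_of_isOpen hΩ le_rfl)

/-- A function that is `C¹` on the compact closure of an open set has bounded gradient. -/
lemma ContDiffOn.exists_norm_gradient_le (hΩ : IsOpen Ω) (hK : IsCompact (closure Ω))
    (hu : ContDiffOn ℝ 1 u (closure Ω)) : ∃ C, ∀ x ∈ Ω, ‖gradient u x‖ ≤ C := by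
  have hloc : ∀ x ∈ closure Ω, ∃ t ∈ 𝓝[closure Ω] x,
      ∃ C, ∀ y ∈ t ∩ Ω, ‖gradient u y‖ ≤ C := by
    intro x hx
    obtain ⟨w, hw, -, f', hf', hcont⟩ :=
      (contDiffWithinAt_succ_iff_hasFDerivWithinAt (n := 0) (by simp)).1 (hu x hx)
    rw [Set.insert_eq_of_mem hx] at hw
    have hbdd : ∀ᶠ y in 𝓝[w] x, ‖f' y‖ < ‖f' x‖ + 1 :=
      hcont.continuousWithinAt.norm.eventually_lt_const (lt_add_one _)
    have hbdd' : ∀ᶠ y in 𝓝[closure Ω] x, ‖f' y‖ < ‖f' x‖ + 1 :=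
      hbdd.filter_mono (nhdsWithin_le_of_mem hw)
    obtain ⟨V, hVo, hxV, hV⟩ := mem_nhdsWithin.1 (Filter.inter_mem hw hbdd')
    refine ⟨V, mem_nhdsWithin_of_mem_nhds (hVo.mem_nhds hxV), ‖f' x‖ + 1, ?_⟩
    rintro y ⟨hyV, hyΩ⟩
    have hy := hV ⟨hyV, subset_closure hyΩ⟩
    have hwy : w ∈ 𝓝 y := Filter.mem_of_superset ((hVo.inter hΩ).mem_nhds ⟨hyV, hyΩ⟩)
      fun z hz => (hV ⟨hz.1, subset_closure hz.2⟩).1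
    have hfd : fderiv ℝ u y = f' y := ((hf' y hy.1).hasFDerivAt hwy).fderiv
    rw [gradient, LinearIsometryEquiv.norm_map, hfd]
    exact hy.2.le
  have hglob : ∃ C, ∀ y ∈ closure Ω ∩ Ω, ‖gradient u y‖ ≤ C := by
    refine hK.induction_on (p := fun t => ∃ C, ∀ y ∈ t ∩ Ω, ‖gradient u y‖ ≤ C)
      ⟨0, by simp⟩ ?_ ?_ hloc
    · rintro s t hst ⟨C, hC⟩
      exact ⟨C, fun y hy => hC y ⟨hst hy.1, hy.2⟩⟩
    · rintro s t ⟨C, hC⟩ ⟨D, hD⟩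
      refine ⟨max C D, ?_⟩
      rintro y ⟨hy | hy, hyΩ⟩
      · exact (hC y ⟨hy, hyΩ⟩).trans (le_max_left _ _)
      · exact (hD y ⟨hy, hyΩ⟩).trans (le_max_right _ _)
  obtain ⟨C, hC⟩ := hglob
  exact ⟨C, fun x hx => hC x ⟨subset_closure hx, hx⟩⟩

end Gradient

/-- The energy density of a `C¹(closure Ω)` function, with a continuous weight, is integrable. -/
lemma integrableOn_mul_energy_density {n : ℕ} {Ω : Set (EuclideanSpace ℝ (Fin n))}
    (hΩ : IsOpen Ω) (hΩb : Bornology.IsBounded Ω) {p : ℝ} (hp : 0 < p)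
    {A : EuclideanSpace ℝ (Fin n) → Matrix (Fin n) (Fin n) ℝ}
    (hA : ContinuousOn A (closure Ω)) {u h : EuclideanSpace ℝ (Fin n) → ℝ}
    (hu : ContDiffOn ℝ 1 u (closure Ω)) (hh : ContinuousOn h (closure Ω)) :
    IntegrableOn
      (fun x => h x * |⟪matCLM (A x) (gradient u x), gradient u x⟫| ^ (p / 2)) Ω := by
  have hK : IsCompact (closure Ω) := hΩb.isCompact_closure
  have hg := (hu.mono subset_closure).continuousOn_gradient hΩ
  have hM : ContinuousOn (fun x => matCLM (A x)) (closure Ω) :=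
    continuous_matCLM.comp_continuousOn hA
  obtain ⟨C, hC⟩ := hu.exists_norm_gradient_le hΩ hK
  obtain ⟨B, hB⟩ := hK.exists_bound_of_continuousOn hM
  obtain ⟨H, hH⟩ := hK.exists_bound_of_continuousOn hh
  have hcont : ContinuousOn
      (fun x => h x * |⟪matCLM (A x) (gradient u x), gradient u x⟫| ^ (p / 2)) Ω :=
    (hh.mono subset_closure).mul
      ((((hM.mono subset_closure).clm_apply hg).inner hg).abs.rpow_const
        fun _ _ => Or.inr (by positivity))
  refine IntegrableOn.of_bound hΩb.measure_lt_top
    (hcont.aestronglyMeasurable hΩ.measurableSet) (H * (B * C * C) ^ (p / 2)) ?_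
  refine (ae_restrict_iff' hΩ.measurableSet).2 (Filter.Eventually.of_forall fun x hx => ?_)
  have hx' := subset_closure hx
  have hB0 : 0 ≤ B := (norm_nonneg _).trans (hB x hx')
  have hC0 : 0 ≤ C := (norm_nonneg _).trans (hC x hx)
  have hH0 : 0 ≤ H := (norm_nonneg _).trans (hH x hx')
  have hq : |⟪matCLM (A x) (gradient u x), gradient u x⟫| ≤ B * C * C :=
    calc |⟪matCLM (A x) (gradient u x), gradient u x⟫|
        ≤ ‖matCLM (A x) (gradient u x)‖ * ‖gradient u x‖ := abs_real_inner_le_norm _ _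
      _ ≤ (‖matCLM (A x)‖ * ‖gradient u x‖) * ‖gradient u x‖ := by
          gcongr
          exact ContinuousLinearMap.le_opNorm _ _
      _ ≤ B * C * C := by
          gcongr
          exacts [hB x hx', hC x hx, hC x hx]
  rw [norm_mul, Real.norm_of_nonneg (Real.rpow_nonneg (abs_nonneg _) (p / 2))]
  exact mul_le_mul (hH x hx') (Real.rpow_le_rpow (abs_nonneg _) hq (by positivity))
    (by positivity) hH0

/-- **Monotonicity inequality** (Lemma 2.2): if `u₂` solves the weighted
`p`-Laplace equation for `σ₂` and `u₁` minimizes the `σ₁`-energy among `C¹`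
functions with the same boundary values as `u₂`, then
`(p-1) ∫ σ₂ σ₁^{-1/(p-1)} (σ₁^{1/(p-1)} - σ₂^{1/(p-1)}) |A∇u₂·∇u₂|^{p/2}
  ≤ E_{σ₁,A}(u₁) - E_{σ₂,A}(u₂) ≤ ∫ (σ₁ - σ₂) |A∇u₂·∇u₂|^{p/2}`. -/
theorem monotonicity_inequality
    {n : ℕ} (hn : 2 ≤ n) (Ω : Set (EuclideanSpace ℝ (Fin n)))
    (hΩopen : IsOpen Ω) (hΩbdd : Bornology.IsBounded Ω)
    (p : ℝ) (hp1 : 1 < p) (c₀ : ℝ) (hc₀ : 0 < c₀)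
    (σ₁ σ₂ : EuclideanSpace ℝ (Fin n) → ℝ)
    (hσ₁cont : ContinuousOn σ₁ (closure Ω)) (hσ₂cont : ContinuousOn σ₂ (closure Ω))
    (hσ₁pos : ∀ x ∈ Ω, c₀ ≤ σ₁ x) (hσ₂pos : ∀ x ∈ Ω, c₀ ≤ σ₂ x)
    (A : EuclideanSpace ℝ (Fin n) → Matrix (Fin n) (Fin n) ℝ)
    (hAcont : ContinuousOn A (closure Ω))
    (hAsymm : ∀ x ∈ Ω, (A x).IsSymm)
    (hAell : ∀ x ∈ Ω, ∀ ξ : EuclideanSpace ℝ (Fin n),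
      c₀ * ‖ξ‖ ^ 2 ≤ ⟪matCLM (A x) ξ, ξ⟫)
    (u₁ u₂ : EuclideanSpace ℝ (Fin n) → ℝ)
    (hu₁C1 : ContDiffOn ℝ 1 u₁ (closure Ω)) (hu₂C1 : ContDiffOn ℝ 1 u₂ (closure Ω))
    (hu₂sol : IsWeakSolution Ω p σ₂ A u₂)
    (hbdry : ∀ x ∈ frontier Ω, u₁ x = u₂ x)
    (hu₁min : ∀ v : EuclideanSpace ℝ (Fin n) → ℝ, ContDiffOn ℝ 1 v (closure Ω) →
      (∀ x ∈ frontier Ω, v x = u₂ x) → energy Ω p σ₁ A u₁ ≤ energy Ω p σ₁ A v) :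
    (p - 1) * ∫ x in Ω, (σ₂ x / σ₁ x ^ (1 / (p - 1)))
        * (σ₁ x ^ (1 / (p - 1)) - σ₂ x ^ (1 / (p - 1)))
        * |⟪matCLM (A x) (gradient u₂ x), gradient u₂ x⟫| ^ (p / 2)
      ≤ energy Ω p σ₁ A u₁ - energy Ω p σ₂ A u₂ ∧
    energy Ω p σ₁ A u₁ - energy Ω p σ₂ A u₂
      ≤ ∫ x in Ω, (σ₁ x - σ₂ x)
        * |⟪matCLM (A x) (gradient u₂ x), gradient u₂ x⟫| ^ (p / 2) := by
  have hp0 : 0 < p := by linarith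
  have hr : 0 < 1 / (p - 1) := by
    have : 0 < p - 1 := by linarith
    positivity
  have hσ₁cl : ∀ x ∈ closure Ω, 0 < σ₁ x := fun x hx =>
    hc₀.trans_le (le_on_closure hσ₁pos continuousOn_const hσ₁cont hx)
  have hpow₁ : ContinuousOn (fun x => σ₁ x ^ (1 / (p - 1))) (closure Ω) :=
    hσ₁cont.rpow_const fun _ _ => Or.inr hr.le
  have hpow₂ : ContinuousOn (fun x => σ₂ x ^ (1 / (p - 1))) (closure Ω) :=
    hσ₂cont.rpow_const fun _ _ => Or.inr hr.le
  have hquot : ContinuousOn (fun x => σ₂ x / σ₁ x ^ (1 / (p - 1))) (closure Ω) :=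
    hσ₂cont.div hpow₁ fun x hx => (Real.rpow_pos_of_pos (hσ₁cl x hx) _).ne'
  have hint {h u : EuclideanSpace ℝ (Fin n) → ℝ} (hu : ContDiffOn ℝ 1 u (closure Ω))
      (hh : ContinuousOn h (closure Ω)) :=
    integrableOn_mul_energy_density hΩopen hΩbdd hp0 hAcont hu hh
  have hI₁₁ := hint hu₁C1 hσ₁cont
  have hI₁₂ := hint hu₂C1 hσ₁cont
  have hI₂₂ := hint hu₂C1 hσ₂cont
  constructor
  · have hIY := (hint hu₂C1 (hquot.fun_mul hpow₂)).const_mul (p - 1)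
    have hIL := (hint hu₂C1 (hquot.fun_mul (hpow₁.fun_sub hpow₂))).const_mul (p - 1)
    have hg₁ := (hu₁C1.mono subset_closure).continuousOn_gradient hΩopen
    have hg₂ := (hu₂C1.mono subset_closure).continuousOn_gradient hΩopen
    have hAg₂ : ContinuousOn (fun x => matCLM (A x) (gradient u₂ x)) Ω :=
      (continuous_matCLM.comp_continuousOn (hAcont.mono subset_closure)).clm_apply hg₂
    have hpos : ∀ x ∈ Ω, ∀ ξ : EuclideanSpace ℝ (Fin n), 0 ≤ ⟪matCLM (A x) ξ, ξ⟫ :=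
      fun x hx ξ => le_trans (by positivity) (hAell x hx ξ)
    have hyoung : ∀ x ∈ Ω,
        p * (σ₂ x * |⟪matCLM (A x) (gradient u₂ x), gradient u₂ x⟫| ^ ((p - 2) / 2)
          * |⟪matCLM (A x) (gradient u₂ x), gradient u₁ x⟫|) ≤
        σ₁ x * |⟪matCLM (A x) (gradient u₁ x), gradient u₁ x⟫| ^ (p / 2)
          + (p - 1) * ((σ₂ x / σ₁ x ^ (1 / (p - 1)) * σ₂ x ^ (1 / (p - 1)))
            * |⟪matCLM (A x) (gradient u₂ x), gradient u₂ x⟫| ^ (p / 2)) := fun x hx =>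
      weighted_young hp1 (abs_nonneg _) (abs_nonneg _)
        (by
          rw [abs_of_nonneg (hpos x hx _), abs_of_nonneg (hpos x hx _)]
          exact inner_matCLM_sq_le (hAsymm x hx) (hpos x hx) _ _)
        (hc₀.trans_le (hσ₁pos x hx)) (hc₀.trans_le (hσ₂pos x hx))
    have hIc : IntegrableOn (fun x =>
        p * (σ₂ x * |⟪matCLM (A x) (gradient u₂ x), gradient u₂ x⟫| ^ ((p - 2) / 2)
          * ⟪matCLM (A x) (gradient u₂ x), gradient u₁ x⟫)) Ω := by
      refine Integrable.mono' (hI₁₁.add hIY) ?_ ?_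
      · have hq := ((hAg₂.inner (𝕜 := ℝ) hg₂).abs.aemeasurable
          (μ := volume) hΩopen.measurableSet).pow_const ((p - 2) / 2)
        have hσ := (hσ₂cont.mono subset_closure).aemeasurable
          (μ := volume) hΩopen.measurableSet
        have hc := (hAg₂.inner (𝕜 := ℝ) hg₁).aemeasurable (μ := volume) hΩopen.measurableSet
        exact (((hσ.mul hq).mul hc).const_mul p).aestronglyMeasurable
      · refine (ae_restrict_iff' hΩopen.measurableSet).2
          (Filter.Eventually.of_forall fun x hx => ?_)
        have hσ₂x : 0 < σ₂ x := hc₀.trans_le (hσ₂pos x hx)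
        rw [Real.norm_eq_abs, abs_mul, abs_mul, abs_of_pos hp0,
          abs_of_nonneg (mul_nonneg hσ₂x.le (Real.rpow_nonneg (abs_nonneg _) _))]
        exact hyoung x hx
    have hweak : ∫ x in Ω,
          p * (σ₂ x * |⟪matCLM (A x) (gradient u₂ x), gradient u₂ x⟫| ^ ((p - 2) / 2)
            * ⟪matCLM (A x) (gradient u₂ x), gradient u₁ x⟫)
        = p * energy Ω p σ₂ A u₂ := by
      have h0 := hu₂sol (fun x => u₁ x - u₂ x) (hu₁C1.sub hu₂C1)
        fun x hx => sub_eq_zero.2 (hbdry x hx)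
      rw [energy, ← integral_const_mul, ← sub_eq_zero,
        ← integral_sub hIc (hI₂₂.const_mul p)]
      rw [← mul_zero p, ← h0, ← integral_const_mul]
      refine setIntegral_congr_fun hΩopen.measurableSet fun x hx => ?_
      have hd₁ : DifferentiableAt ℝ u₁ x := (hu₁C1.differentiableOn one_ne_zero).differentiableAt
        (Filter.mem_of_superset (hΩopen.mem_nhds hx) subset_closure)
      have hd₂ : DifferentiableAt ℝ u₂ x := (hu₂C1.differentiableOn one_ne_zero).differentiableAt
        (Filter.mem_of_superset (hΩopen.mem_nhds hx) subset_closure)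
      have hgrad : gradient (fun y => u₁ y - u₂ y) x = gradient u₁ x - gradient u₂ x := by
        simp only [gradient]
        rw [fderiv_fun_sub hd₁ hd₂, map_sub]
      have hpow : |⟪matCLM (A x) (gradient u₂ x), gradient u₂ x⟫| ^ ((p - 2) / 2)
          * ⟪matCLM (A x) (gradient u₂ x), gradient u₂ x⟫
          = |⟪matCLM (A x) (gradient u₂ x), gradient u₂ x⟫| ^ (p / 2) := by
        have ha := hpos x hx (gradient u₂ x)
        rw [abs_of_nonneg ha]
        nth_rewrite 2 [← Real.rpow_one ⟪matCLM (A x) (gradient u₂ x), gradient u₂ x⟫]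
        have e : (p - 2) / 2 + 1 = p / 2 := by ring
        rw [← Real.rpow_add' ha (by rw [e]; positivity), e]
      simp only [hgrad, inner_sub_right, ← hpow]
      ring
    have hmono : (∫ x in Ω,
          (p * (σ₂ x * |⟪matCLM (A x) (gradient u₂ x), gradient u₂ x⟫| ^ ((p - 2) / 2)
            * ⟪matCLM (A x) (gradient u₂ x), gradient u₁ x⟫)
          + (p - 1) * ((σ₂ x / σ₁ x ^ (1 / (p - 1))
              * (σ₁ x ^ (1 / (p - 1)) - σ₂ x ^ (1 / (p - 1))))
            * |⟪matCLM (A x) (gradient u₂ x), gradient u₂ x⟫| ^ (p / 2))))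
        ≤ ∫ x in Ω, (σ₁ x * |⟪matCLM (A x) (gradient u₁ x), gradient u₁ x⟫| ^ (p / 2)
          + (p - 1) * (σ₂ x * |⟪matCLM (A x) (gradient u₂ x), gradient u₂ x⟫| ^ (p / 2))) := by
      refine setIntegral_mono_on (hIc.add hIL) (hI₁₁.add (hI₂₂.const_mul (p - 1)))
        hΩopen.measurableSet fun x hx => ?_
      have hσ₂x : 0 < σ₂ x := hc₀.trans_le (hσ₂pos x hx)
      have hle : p * (σ₂ x * |⟪matCLM (A x) (gradient u₂ x), gradient u₂ x⟫| ^ ((p - 2) / 2)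
            * ⟪matCLM (A x) (gradient u₂ x), gradient u₁ x⟫)
          ≤ p * (σ₂ x * |⟪matCLM (A x) (gradient u₂ x), gradient u₂ x⟫| ^ ((p - 2) / 2)
            * |⟪matCLM (A x) (gradient u₂ x), gradient u₁ x⟫|) := by
        gcongr
        exact le_abs_self _
      have hsplit : σ₂ x / σ₁ x ^ (1 / (p - 1))
            * (σ₁ x ^ (1 / (p - 1)) - σ₂ x ^ (1 / (p - 1)))
          = σ₂ x - σ₂ x / σ₁ x ^ (1 / (p - 1)) * σ₂ x ^ (1 / (p - 1)) := by
        rw [mul_sub, div_mul_cancel₀ _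
          (Real.rpow_pos_of_pos (hc₀.trans_le (hσ₁pos x hx)) _).ne']
      rw [hsplit]
      linarith [hyoung x hx]
    rw [integral_add hIc hIL, integral_add hI₁₁ (hI₂₂.const_mul (p - 1)), hweak,
      integral_const_mul, integral_const_mul] at hmono
    simp only [energy] at hmono ⊢
    linarith
  · have hmin := hu₁min u₂ hu₂C1 fun _ _ => rfl
    have hsub : ∫ x in Ω, (σ₁ x - σ₂ x)
          * |⟪matCLM (A x) (gradient u₂ x), gradient u₂ x⟫| ^ (p / 2)
        = energy Ω p σ₁ A u₂ - energy Ω p σ₂ A u₂ := by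
      rw [energy, energy, ← integral_sub hI₁₂ hI₂₂]
      simp only [sub_mul]
    rw [hsub]
    linarith
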